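/- Let f : X → ℝ^d have l₂-sensitivity Δ = max over neighboring datasets X, X' of ‖f(X) − f(X')‖. For ε ∈ (0,1) and δ ∈ (0,1), the Gaussian mechanism M(X) = f(X) + N(0, σ²I_d) with σ ≥ (Δ/ε)·√(2·ln(1.25/δ)) is (ε,δ)-differentially private: for every measurable T ⊆ ℝ^d and neighboring X, X', P[M(X) ∈ T] ≤ e^ε·P[M(X') ∈ T] + δ. -/

import Mathlib

open MeasureTheory ProbabilityTheory Real

lemma gaussianReal_le_mul_of_pdf_le {a b K : ℝ} {v : NNReal} (hv : v ≠ 0) (hK : 0 ≤ K)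
    {S : Set ℝ} (h : ∀ x ∈ S, gaussianPDFReal a v x ≤ K * gaussianPDFReal b v x) :
    gaussianReal a v S ≤ ENNReal.ofReal K * gaussianReal b v S := by
  rw [gaussianReal_apply _ hv, gaussianReal_apply _ hv,
    ← lintegral_const_mul _ (measurable_gaussianPDF _ _)]
  refine setLIntegral_mono ((measurable_gaussianPDF _ _).const_mul _) fun x hx => ?_
  rw [gaussianPDF, gaussianPDF, ← ENNReal.ofReal_mul hK]
  exact ENNReal.ofReal_le_ofReal (h x hx)

lemma gaussianReal_preimage_add_const (m a : ℝ) (v : NNReal) {S : Set ℝ} (hS : MeasurableSet S) :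
    gaussianReal m v ((fun x => x + a) ⁻¹' S) = gaussianReal (m + a) v S := by
  rw [← gaussianReal_map_add_const a, Measure.map_apply (by fun_prop) hS]

lemma gaussianPDFReal_one_le_exp_mul {a b x s : ℝ} (h : (x - b) ^ 2 / 2 - (x - a) ^ 2 / 2 ≤ s) :
    gaussianPDFReal a 1 x ≤ exp s * gaussianPDFReal b 1 x := by
  simp only [gaussianPDFReal_def, NNReal.coe_one, mul_one]
  rw [mul_left_comm, ← exp_add]
  gcongr
  linarith

lemma gaussianReal_zero_one_Ioi_zero_le : gaussianReal 0 1 (Set.Ioi 0) ≤ ENNReal.ofReal (1 / 2) := by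
  have hsymm : gaussianReal 0 1 (Set.Iio 0) = gaussianReal 0 1 (Set.Ioi 0) := by
    conv_rhs => rw [← neg_zero (G := ℝ), ← gaussianReal_map_neg,
      Measure.map_apply measurable_neg measurableSet_Ioi]
    congr 1
    ext x
    simp
  have hsum : (gaussianReal 0 1).real (Set.Ioi 0) + (gaussianReal 0 1).real (Set.Iio 0) ≤ 1 := by
    rw [← measureReal_union (Set.Ioi_disjoint_Iio_same) measurableSet_Iio]
    exact measureReal_le_one
  rw [measureReal_def, measureReal_def, hsymm, ← measureReal_def] at hsum
  rw [← ofReal_measureReal]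
  exact ENNReal.ofReal_le_ofReal (by linarith)

lemma gaussianReal_zero_one_Ioi_le_of_nonneg {t : ℝ} (ht : 0 ≤ t) :
    gaussianReal 0 1 (Set.Ioi t) ≤ ENNReal.ofReal (exp (-t ^ 2 / 2) * (1 / 2)) := by
  have hshift : gaussianReal 0 1 (Set.Ioi t) = gaussianReal (-t) 1 (Set.Ioi 0) := by
    rw [← zero_add (-t), ← gaussianReal_preimage_add_const _ _ _ measurableSet_Ioi]
    congr 1
    ext x
    simp
  rw [hshift, ENNReal.ofReal_mul (exp_pos _).le]
  refine (gaussianReal_le_mul_of_pdf_le (b := 0) one_ne_zero (exp_pos (-t ^ 2 / 2)).le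
    fun x hx => gaussianPDFReal_one_le_exp_mul ?_).trans
    (mul_le_mul_right gaussianReal_zero_one_Ioi_zero_le _)
  nlinarith [mul_nonneg ht (le_of_lt (Set.mem_Ioi.1 hx))]

lemma gaussianReal_zero_one_Ioi_le_of_nonpos {t : ℝ} (ht : t ≤ 0) :
    gaussianReal 0 1 (Set.Ioi t) ≤ ENNReal.ofReal (1 / 2 + -t / 2) := by
  have hpdf (x : ℝ) : gaussianPDF 0 1 x ≤ ENNReal.ofReal (1 / 2) := by
    refine ENNReal.ofReal_le_ofReal ?_
    simp only [gaussianPDFReal_def, NNReal.coe_one, mul_one]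
    have h1 : (2 : ℝ) ≤ √(2 * π) := Real.le_sqrt_of_sq_le (by nlinarith [pi_gt_three])
    have h2 : (√(2 * π))⁻¹ ≤ 1 / 2 := by
      rw [one_div]
      exact inv_anti₀ (by norm_num) h1
    have h3 : exp (-(x - 0) ^ 2 / 2) ≤ 1 := exp_le_one_iff.2 (by nlinarith [sq_nonneg (x - 0)])
    calc _ ≤ (1 / 2 : ℝ) * 1 := by gcongr
      _ = 1 / 2 := mul_one _
  have hIoc : gaussianReal 0 1 (Set.Ioc t 0) ≤ ENNReal.ofReal (-t / 2) := by
    rw [gaussianReal_apply _ one_ne_zero]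
    refine (setLIntegral_mono measurable_const fun x _ => hpdf x).trans ?_
    rw [setLIntegral_const, Real.volume_Ioc, ← ENNReal.ofReal_mul (by norm_num)]
    exact ENNReal.ofReal_le_ofReal (by linarith)
  rw [← Set.Ioc_union_Ioi_eq_Ioi ht, ENNReal.ofReal_add (by norm_num) (by linarith), add_comm]
  exact (measure_union_le _ _).trans (add_le_add hIoc gaussianReal_zero_one_Ioi_zero_le)

lemma gaussianReal_zero_one_tail_le {ε c δ : ℝ} (hε0 : 0 < ε) (hε1 : ε < 1) (hδ1 : δ < 1)
    (hc : 0 < c) (hδ : 1.25 * exp (-c ^ 2 / 2) ≤ δ) :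
    gaussianReal 0 1 (Set.Ioi (c - ε / (2 * c))) ≤ ENNReal.ofReal δ := by
  rcases le_total 0 (c - ε / (2 * c)) with ht | ht
  · refine (gaussianReal_zero_one_Ioi_le_of_nonneg ht).trans (ENNReal.ofReal_le_ofReal ?_)
    have hsq : (c - ε / (2 * c)) ^ 2 = c ^ 2 - ε + (ε / (2 * c)) ^ 2 := by
      field_simp
      ring
    have hhalf : exp (-(c - ε / (2 * c)) ^ 2 / 2) ≤ exp (1 / 2) * exp (-c ^ 2 / 2) := by
      rw [← exp_add]
      gcongr
      nlinarith [sq_nonneg (ε / (2 * c))]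
    have hroot : exp (1 / 2) ≤ 2.5 := by
      have h : exp (1 / 2) * exp (1 / 2) = exp 1 := by rw [← exp_add]; norm_num
      nlinarith [exp_one_lt_d9, exp_pos (1 / 2)]
    nlinarith [exp_pos (-c ^ 2 / 2)]
  · refine (gaussianReal_zero_one_Ioi_le_of_nonpos ht).trans (ENNReal.ofReal_le_ofReal ?_)
    have hlow : 0.4 ≤ c ^ 2 := by
      nlinarith [add_one_le_exp (-c ^ 2 / 2)]
    have hc6 : 0.6 ≤ c := by nlinarith
    have ht' : c * (c - ε / (2 * c)) = c ^ 2 - ε / 2 := by field_simp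
    have hup : c ^ 2 ≤ 1 / 2 := by nlinarith [mul_nonpos_of_nonneg_of_nonpos hc.le ht]
    have hbound : -(c - ε / (2 * c)) ≤ 1 / 6 := by nlinarith
    nlinarith [add_one_le_exp (-c ^ 2 / 2)]

lemma gaussianReal_shift_le {ε c δ : ℝ} (hε0 : 0 < ε) (hε1 : ε < 1) (hδ1 : δ < 1)
    (hc : 0 < c) (hδ : 1.25 * exp (-c ^ 2 / 2) ≤ δ) {S : Set ℝ} (hS : MeasurableSet S) :
    gaussianReal 0 1 ((fun z => z + ε / c) ⁻¹' S) ≤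
      ENNReal.ofReal (exp ε) * gaussianReal 0 1 S + ENNReal.ofReal δ := by
  rw [gaussianReal_preimage_add_const _ _ _ hS, zero_add,
    ← measure_inter_add_sdiff S (measurableSet_Iic (a := c + ε / (2 * c)))]
  refine add_le_add ?_ ?_
  · refine (gaussianReal_le_mul_of_pdf_le (b := 0) one_ne_zero (exp_pos ε).le
      fun x hx => gaussianPDFReal_one_le_exp_mul ?_).trans
      (mul_le_mul_right (measure_mono Set.inter_subset_left) _)
    have h1 : ε / c * x ≤ ε / c * (c + ε / (2 * c)) :=
      mul_le_mul_of_nonneg_left hx.2 (by positivity)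
    have h2 : ε / c * (c + ε / (2 * c)) = ε + (ε / c) ^ 2 / 2 := by
      field_simp
    nlinarith
  · refine le_trans ?_ (gaussianReal_zero_one_tail_le hε0 hε1 hδ1 hc hδ)
    calc gaussianReal (ε / c) 1 (S \ Set.Iic (c + ε / (2 * c)))
        ≤ gaussianReal (0 + ε / c) 1 (Set.Ioi (c + ε / (2 * c))) := by
          rw [zero_add]
          exact measure_mono fun x hx => Set.mem_Ioi.2 (lt_of_not_ge hx.2)
      _ = gaussianReal 0 1 (Set.Ioi (c - ε / (2 * c))) := by
          rw [← gaussianReal_preimage_add_const _ _ _ measurableSet_Ioi]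
          congr 1
          ext x
          have : ε / c = 2 * (ε / (2 * c)) := by field_simp
          simp only [Set.mem_preimage, Set.mem_Ioi]
          constructor <;> intro h <;> linarith

section StdGaussian

variable {E : Type*} [NormedAddCommGroup E] [InnerProductSpace ℝ E] [FiniteDimensional ℝ E]
  [MeasurableSpace E] [BorelSpace E]

lemma stdGaussian_eq_map_prod {u : E} (hu : ‖u‖ = 1) :
    stdGaussian E = ((gaussianReal 0 1).prod (stdGaussian E)).map
      (fun p => p.1 • u + (p.2 - inner ℝ u p.2 • u)) := by
  apply Measure.ext_of_charFun
  ext t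
  have hnorm : ‖t‖ ^ 2 = inner ℝ u t ^ 2 + ‖t - inner ℝ u t • u‖ ^ 2 := by
    rw [norm_sub_sq_real, norm_smul, hu, real_inner_smul_right, real_inner_comm, mul_one,
      Real.norm_eq_abs, sq_abs]
    ring
  have hinner (p : ℝ × E) : inner ℝ (p.1 • u + (p.2 - inner ℝ u p.2 • u)) t =
      inner ℝ u t * p.1 + inner ℝ p.2 (t - inner ℝ u t • u) := by
    simp only [inner_add_left, inner_sub_left, inner_sub_right, real_inner_smul_left,
      real_inner_smul_right, real_inner_comm u p.2]
    ring
  rw [charFun_apply (μ := Measure.map _ _), integral_map (by fun_prop) (by fun_prop)]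
  simp_rw [hinner, Complex.ofReal_add, add_mul, Complex.exp_add]
  rw [integral_prod_mul (fun z : ℝ => Complex.exp (↑(inner ℝ u t * z) * Complex.I))
    (fun w : E => Complex.exp (↑(inner ℝ w (t - inner ℝ u t • u)) * Complex.I))]
  simp_rw [Complex.ofReal_mul]
  rw [← charFun_apply_real, ← charFun_apply, charFun_stdGaussian, charFun_stdGaussian,
    charFun_gaussianReal, ← Complex.exp_add, ← Complex.ofReal_pow, hnorm]
  congr 1
  push_cast
  ring

lemma stdGaussian_preimage_le {ε c δ σ : ℝ} (hε0 : 0 < ε) (hε1 : ε < 1) (hδ1 : δ < 1)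
    (hc : 0 < c) (hδ : 1.25 * exp (-c ^ 2 / 2) ≤ δ) {u : E} (hu : ‖u‖ = 1) (y : E)
    {T : Set E} (hT : MeasurableSet T) :
    stdGaussian E ((fun w => y + (σ * (ε / c)) • u + σ • w) ⁻¹' T) ≤
      ENNReal.ofReal (exp ε) * stdGaussian E ((fun w => y + σ • w) ⁻¹' T) + ENNReal.ofReal δ := by
  have hslice (a : E) : stdGaussian E ((fun w => a + σ • w) ⁻¹' T) =
      ∫⁻ w, gaussianReal 0 1
        ((fun z : ℝ => a + σ • (z • u + (w - inner ℝ u w • u))) ⁻¹' T) ∂stdGaussian E := by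
    have hm : Measurable fun w : E => a + σ • w := by fun_prop
    have hp : Measurable fun p : ℝ × E => p.1 • u + (p.2 - inner ℝ u p.2 • u) := by fun_prop
    conv_lhs => rw [stdGaussian_eq_map_prod hu]
    rw [Measure.map_apply hp (hm hT), Measure.prod_apply_symm (hp (hm hT))]
    rfl
  rw [hslice, hslice]
  calc _ ≤ ∫⁻ w, (ENNReal.ofReal (exp ε) * gaussianReal 0 1
        ((fun z : ℝ => y + σ • (z • u + (w - inner ℝ u w • u))) ⁻¹' T) + ENNReal.ofReal δ)
          ∂stdGaussian E := by
        refine lintegral_mono fun w => ?_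
        have hm : Measurable fun z : ℝ => y + σ • (z • u + (w - inner ℝ u w • u)) := by fun_prop
        refine le_of_eq_of_le ?_ (gaussianReal_shift_le hε0 hε1 hδ1 hc hδ (hm hT))
        rw [← Set.preimage_comp]
        congr 2
        ext z
        simp only [Function.comp_apply]
        module
    _ = _ := by
        rw [lintegral_add_right _ measurable_const,
          lintegral_const_mul' _ _ ENNReal.ofReal_ne_top]
        simp

end StdGaussian

lemma pi_gaussianReal_map_eq_stdGaussian_map (d : ℕ) (σ : ℝ) (y : EuclideanSpace ℝ (Fin d)) :
    (Measure.pi fun _ : Fin d => gaussianReal 0 (σ ^ 2).toNNReal).map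
        (fun v => y + (EuclideanSpace.equiv (Fin d) ℝ).symm v) =
      (stdGaussian (EuclideanSpace ℝ (Fin d))).map (fun w => y + σ • w) := by
  have hscale : gaussianReal 0 (σ ^ 2).toNNReal = (gaussianReal 0 1).map (fun x => σ * x) := by
    rw [gaussianReal_map_const_mul]
    congr 1
    · simp
    · ext
      simp [sq_nonneg]
  rw [hscale, ← Measure.pi_map_pi (fun _ => by fun_prop), ← map_pi_eq_stdGaussian,
    Measure.map_map (by fun_prop) (by fun_prop), Measure.map_map (by fun_prop) (by fun_prop)]
  rfl

theorem stmt16 (d : ℕ) {X : Type*} (Neighbor : X → X → Prop)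
    (f : X → EuclideanSpace ℝ (Fin d))
    (Δ ε δ σ : ℝ) (hε : ε ∈ Set.Ioo (0 : ℝ) 1) (hδ : δ ∈ Set.Ioo (0 : ℝ) 1)
    (hΔ : ∀ x x', Neighbor x x' → ‖f x - f x'‖ ≤ Δ)
    (hσ : σ ≥ Δ / ε * Real.sqrt (2 * Real.log (1.25 / δ)))
    (M : X → Measure (EuclideanSpace ℝ (Fin d)))
    (hM : ∀ x, M x =
      (Measure.pi fun _ : Fin d => gaussianReal 0 (σ ^ 2).toNNReal).map
        (fun v => f x + (EuclideanSpace.equiv (Fin d) ℝ).symm v)) :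
    ∀ x x', Neighbor x x' → ∀ T : Set (EuclideanSpace ℝ (Fin d)), MeasurableSet T →
      M x T ≤ ENNReal.ofReal (Real.exp ε) * M x' T + ENNReal.ofReal δ := by
  obtain ⟨hε0, hε1⟩ := hε
  obtain ⟨hδ0, hδ1⟩ := hδ
  intro x x' hxx' T hT
  by_cases heq : f x = f x'
  · rw [hM x, hM x', heq]
    refine le_add_right (le_mul_of_one_le_left zero_le ?_)
    rw [ENNReal.one_le_ofReal]
    exact one_le_exp hε0.le
  have hw : 0 < ‖f x - f x'‖ := norm_pos_iff.2 (sub_ne_zero.2 heq)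
  have hlog : 0 < log (1.25 / δ) :=
    log_pos ((one_lt_div hδ0).2 (by linarith))
  set w := ‖f x - f x'‖ with hw_def
  set s := √(2 * log (1.25 / δ)) with hs_def
  have hs : 0 < s := sqrt_pos.2 (by positivity)
  have hs_sq : s ^ 2 = 2 * log (1.25 / δ) := sq_sqrt (by positivity)
  have hσw : w / ε * s ≤ σ := le_trans (by gcongr; exact hΔ x x' hxx') hσ
  have hσ0 : 0 < σ := lt_of_lt_of_le (by positivity) hσw
  have hsc : s ≤ σ * ε / w := by
    rw [le_div_iff₀ hw]
    calc s * w = w / ε * s * ε := by field_simp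
      _ ≤ σ * ε := by gcongr
  have htail : 1.25 * exp (-(σ * ε / w) ^ 2 / 2) ≤ δ := by
    have : exp (-(σ * ε / w) ^ 2 / 2) ≤ δ / 1.25 := by
      rw [← exp_log (show 0 < δ / 1.25 by positivity), ← inv_div 1.25 δ, log_inv]
      gcongr
      nlinarith
    calc 1.25 * exp (-(σ * ε / w) ^ 2 / 2) ≤ 1.25 * (δ / 1.25) := by gcongr
      _ = δ := by field_simp
  have hshift : f x' + (σ * (ε / (σ * ε / w))) • (w⁻¹ • (f x - f x')) = f x := by
    rw [smul_smul, show σ * (ε / (σ * ε / w)) * w⁻¹ = 1 by field_simp, one_smul]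
    abel
  have hunit : ‖w⁻¹ • (f x - f x')‖ = 1 := by
    rw [norm_smul, norm_inv, Real.norm_eq_abs, abs_of_pos hw, ← hw_def, inv_mul_cancel₀ hw.ne']
  have key := stdGaussian_preimage_le (σ := σ) hε0 hε1 hδ1 (by positivity) htail hunit (f x') hT
  rw [hshift] at key
  rw [hM x, hM x', pi_gaussianReal_map_eq_stdGaussian_map, pi_gaussianReal_map_eq_stdGaussian_map,
    Measure.map_apply (by fun_prop) hT, Measure.map_apply (by fun_prop) hT]
  exact key
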